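/- Let n and m be positive integers, let A be an m × n matrix of polynomials with integer coefficients in one variable u, and let b be a vector of m such polynomials. For each positive integer t let R(t) = {x ∈ ℝ^n : A(t)x ≤ b(t)} (inequalities coordinate-wise), and assume R(t) is bounded for every positive integer t. Let g(t) be the number of points of ℤ^n lying in R(t). Then g is eventually quasi-polynomial. -/

import Mathlib

/-- Evaluation of an integer polynomial at a positive integer `t`. -/
def evalAt (p : Polynomial ℤ) (t : ℕ) : ℤ := p.eval (t : ℤ)

/-- A function `f` (on sufficiently large positive integers) is eventually
quasi-polynomial if there are a period `d > 0` and rational polynomials `R₀, …, R_{d-1}`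
with `f t = R_{t mod d}(t)` for all sufficiently large `t`. -/
def IsEQP (f : ℕ → ℤ) : Prop :=
  ∃ d : ℕ, 0 < d ∧ ∃ R : ℕ → Polynomial ℚ, ∃ N : ℕ,
    ∀ t : ℕ, N ≤ t → (f t : ℚ) = (R (t % d)).eval (t : ℚ)

open Polynomial

/-- quasi-polynomial functions on the naturals -/
def QP (h : ℕ → ℚ) : Prop :=
  ∃ D : ℕ, 0 < D ∧ ∃ P : ℕ → ℚ[X], ∀ n : ℕ, h n = (P (n % D)).eval (n : ℚ)

theorem QP.op {h h' : ℕ → ℚ} (hh : QP h) (hh' : QP h') (f : ℚ → ℚ → ℚ)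
    (F : ℚ[X] → ℚ[X] → ℚ[X]) (hF : ∀ p q x, (F p q).eval x = f (p.eval x) (q.eval x)) :
    QP (fun n => f (h n) (h' n)) := by
  obtain ⟨D, hD, P, hP⟩ := hh
  obtain ⟨D', hD', P', hP'⟩ := hh'
  refine ⟨D * D', Nat.mul_pos hD hD', fun s => F (P (s % D)) (P' (s % D')), fun n => ?_⟩
  simp only [Nat.mod_mul_right_mod, Nat.mod_mul_left_mod, hF, ← hP, ← hP']

theorem QP.add {h h' : ℕ → ℚ} (hh : QP h) (hh' : QP h') : QP (fun n => h n + h' n) :=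
  hh.op hh' (· + ·) (· + ·) (by simp)

theorem QP.mul {h h' : ℕ → ℚ} (hh : QP h) (hh' : QP h') : QP (fun n => h n * h' n) :=
  hh.op hh' (· * ·) (· * ·) (by simp)

theorem QP.const (c : ℚ) : QP (fun _ => c) :=
  ⟨1, one_pos, fun _ => C c, by simp⟩

theorem QP.id : QP (fun n => (n : ℚ)) :=
  ⟨1, one_pos, fun _ => X, by simp⟩

/-- indicator -/
noncomputable def ind (p : Prop) : ℚ := by
  classical exact if p then 1 else 0

theorem ind_true {p : Prop} (h : p) : ind p = 1 := by simp [ind, h]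
theorem ind_false {p : Prop} (h : ¬ p) : ind p = 0 := by simp [ind, h]

theorem ind_congr {p q : Prop} (h : p ↔ q) : ind p = ind q := by rw [propext h]

theorem ind_and (p q : Prop) : ind (p ∧ q) = ind p * ind q := by
  by_cases h : p <;> by_cases h' : q <;> simp [ind, h, h']

theorem ind_not (p : Prop) : ind (¬ p) = 1 - ind p := by
  by_cases h : p <;> simp [ind, h]

theorem QP.dvd (D : ℤ) (hD : 0 < D) (a b : ℤ) : QP (fun n => ind (D ∣ a * n + b)) := by
  obtain ⟨D, rfl⟩ := Int.eq_ofNat_of_zero_le hD.le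
  refine ⟨D, by exact_mod_cast hD, fun s => C (ind ((D : ℤ) ∣ a * s + b)), fun n => ?_⟩
  rw [eval_C]
  apply ind_congr
  have h : ((D : ℤ)) ∣ (a * n + b) - (a * ((n % D : ℕ) : ℤ) + b) := by
    have : (a * n + b) - (a * ((n % D : ℕ) : ℤ) + b) = D * (a * (n / D : ℕ)) := by
      have := Nat.mod_add_div n D
      have h2 : (n : ℤ) = ((n % D : ℕ) : ℤ) + D * ((n / D : ℕ) : ℤ) := by exact_mod_cast this.symm
      linear_combination a * h2
    exact ⟨_, this⟩
  exact dvd_iff_dvd_of_dvd_sub h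

theorem faulhaber (p : ℚ[X]) : ∃ P : ℚ[X], ∀ n : ℕ, ∑ i ∈ Finset.range n, p.eval (i : ℚ) = P.eval (n : ℚ) := by
  induction p using Polynomial.induction_on' with
  | add p q hp hq =>
    obtain ⟨P, hP⟩ := hp
    obtain ⟨Q, hQ⟩ := hq
    exact ⟨P + Q, fun n => by simp [Finset.sum_add_distrib, hP, hQ]⟩
  | monomial k a =>
    refine ⟨C (a / (k + 1)) * (Polynomial.bernoulli (k + 1) - C (_root_.bernoulli (k + 1))), fun n => ?_⟩
    have h := Polynomial.sum_range_pow_eq_bernoulli_sub n k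
    simp only [eval_monomial, ← Finset.mul_sum, eval_mul, eval_sub, eval_C]
    have hk : (k : ℚ) + 1 ≠ 0 := by positivity
    field_simp
    linear_combination a * h

theorem QP.sum {h : ℕ → ℚ} (hh : QP h) : QP (fun N => ∑ y ∈ Finset.range N, h y) := by
  obtain ⟨D, hD, P, hP⟩ := hh
  have key : ∀ s q, s < D → h (D * q + s) = ((P s).comp (C (D : ℚ) * X + C (s : ℚ))).eval (q : ℚ) := by
    intro s q hs
    rw [hP]
    simp [Nat.mod_eq_of_lt hs]
  obtain ⟨R, hR⟩ := faulhaber (∑ s ∈ Finset.range D, (P s).comp (C (D : ℚ) * X + C (s : ℚ)))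
  have h1 : ∀ q : ℕ, ∑ y ∈ Finset.range (D * q), h y = R.eval (q : ℚ) := by
    intro q
    rw [← hR]
    induction q with
    | zero => simp
    | succ q ih =>
      rw [Nat.mul_succ, Finset.sum_range_add, ih, Finset.sum_range_succ, eval_finsetSum]
      congr 1
      exact Finset.sum_congr rfl fun s hs => key s q (Finset.mem_range.1 hs)
  refine ⟨D, hD, fun s => (R + ∑ s' ∈ Finset.range s, (P s').comp (C (D : ℚ) * X + C (s' : ℚ))).comp
    (C (1 / (D : ℚ)) * (X - C (s : ℚ))), fun N => ?_⟩
  have hN := Nat.div_add_mod N D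
  have hs := Nat.mod_lt N hD
  generalize N % D = s at *
  generalize N / D = q at *
  subst hN
  have hD' : (D : ℚ) ≠ 0 := by positivity
  have : (C (1 / (D : ℚ)) * (X - C (s : ℚ)) : ℚ[X]).eval (((D * q + s : ℕ)) : ℚ) = q := by
    simp; field_simp
  dsimp only
  rw [eval_comp, this, eval_add, Finset.sum_range_add, h1, eval_finsetSum]
  congr 1
  exact Finset.sum_congr rfl fun s' hs' => key s' q ((Finset.mem_range.1 hs').trans hs)

/-- the algebra of piecewise quasi-polynomials over a group of affine functions -/
def Qalg {X : Type} (A : AddSubgroup (X → ℤ)) : Subalgebra ℚ (X → ℚ) :=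
  Algebra.adjoin ℚ ({f | ∃ l ∈ A, f = fun x => (l x : ℚ)} ∪
    {f | ∃ l ∈ A, f = fun x => ind (0 ≤ l x)} ∪
    {f | ∃ l ∈ A, ∃ D : ℤ, 0 < D ∧ f = fun x => ind (D ∣ l x)})

section
variable {X : Type} {A : AddSubgroup (X → ℤ)}

theorem Qalg.cast {l : X → ℤ} (hl : l ∈ A) : (fun x => (l x : ℚ)) ∈ Qalg A :=
  Algebra.subset_adjoin (Or.inl (Or.inl ⟨l, hl, rfl⟩))

theorem Qalg.nonneg {l : X → ℤ} (hl : l ∈ A) : (fun x => ind (0 ≤ l x)) ∈ Qalg A :=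
  Algebra.subset_adjoin (Or.inl (Or.inr ⟨l, hl, rfl⟩))

theorem Qalg.dvd {l : X → ℤ} (hl : l ∈ A) {D : ℤ} (hD : 0 < D) :
    (fun x => ind (D ∣ l x)) ∈ Qalg A :=
  Algebra.subset_adjoin (Or.inr ⟨l, hl, D, hD, rfl⟩)

theorem Qalg.const (c : ℚ) : (fun _ => c) ∈ Qalg A := (Qalg A).algebraMap_mem c

theorem Qalg.le {l l' : X → ℤ} (hl : l ∈ A) (hl' : l' ∈ A) :
    (fun x => ind (l x ≤ l' x)) ∈ Qalg A := by
  have := Qalg.nonneg (A.sub_mem hl' hl)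
  convert this using 2 with x
  apply ind_congr
  simp

theorem Qalg.not {p : X → Prop} (hp : (fun x => ind (p x)) ∈ Qalg A) :
    (fun x => ind (¬ p x)) ∈ Qalg A := by
  simp only [ind_not]
  exact (Qalg A).sub_mem (Qalg A).one_mem hp

theorem Qalg.and {p q : X → Prop} (hp : (fun x => ind (p x)) ∈ Qalg A)
    (hq : (fun x => ind (q x)) ∈ Qalg A) :
    (fun x => ind (p x ∧ q x)) ∈ Qalg A := by
  simp only [ind_and]
  exact (Qalg A).mul_mem hp hq

/-- splitting along a predicate -/
theorem Qalg.split {p : X → Prop} (hp : (fun x => ind (p x)) ∈ Qalg A) {f g g' : X → ℚ}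
    (hg : g ∈ Qalg A) (hg' : g' ∈ Qalg A) (h : ∀ x, p x → f x = g x)
    (h' : ∀ x, ¬ p x → f x = g' x) : f ∈ Qalg A := by
  have : f = (fun x => ind (p x)) * g + (fun x => ind (¬ p x)) * g' := by
    funext x
    by_cases hx : p x
    · simp [ind, hx, h x hx]
    · simp [ind, hx, h' x hx]
  rw [this]
  have hnp := Qalg.not hp
  exact add_mem (mul_mem hp hg) (mul_mem hnp hg' : _ ∈ Qalg A)

/-- splitting along finitely many values -/
theorem Qalg.split_fin (S : Finset ℤ) (v : X → ℤ) (hv : ∀ x, v x ∈ S)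
    (hi : ∀ s ∈ S, (fun x => ind (v x = s)) ∈ Qalg A) {f : X → ℚ} (g : ℤ → X → ℚ)
    (hg : ∀ s ∈ S, g s ∈ Qalg A) (h : ∀ s ∈ S, ∀ x, v x = s → f x = g s x) : f ∈ Qalg A := by
  have : f = ∑ s ∈ S, (fun x => ind (v x = s)) * g s := by
    funext x
    rw [Finset.sum_apply, Finset.sum_eq_single (v x)]
    · simp [ind, h _ (hv x) x rfl]
    · intro s _ hs
      simp [ind, hs.symm]
    · intro h
      exact absurd (hv x) h
  rw [this]
  exact (Qalg A).sum_mem fun s hs => (Qalg A).mul_mem (hi s hs) (hg s hs)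

/-- splitting along residues -/
theorem Qalg.split_mod {l : X → ℤ} {D : ℤ} (hD : 0 < D)
    (hi : ∀ r : ℤ, (fun x => ind (D ∣ l x - r)) ∈ Qalg A) {f : X → ℚ}
    (hg : ∀ r : ℤ, 0 ≤ r → r < D → ∃ g ∈ Qalg A, ∀ x, l x % D = r → f x = g x) : f ∈ Qalg A := by
  choose! g hg using hg
  refine Qalg.split_fin (Finset.Ico 0 D) (fun x => l x % D) ?_ ?_ g ?_ ?_
  · intro x
    simp [Int.emod_nonneg _ hD.ne', Int.emod_lt_of_pos _ hD]
  · intro s hs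
    rw [Finset.mem_Ico] at hs
    convert hi s using 2 with x
    apply ind_congr
    rw [← Int.emod_emod_of_dvd (l x) (dvd_refl D)] 
    rw [← Int.emod_eq_emod_iff_emod_sub_eq_zero.trans Int.dvd_iff_emod_eq_zero.symm]
    rw [Int.emod_eq_of_lt hs.1 hs.2, Int.emod_emod_of_dvd (l x) (dvd_refl D)]
  · intro s hs
    rw [Finset.mem_Ico] at hs
    exact (hg s hs.1 hs.2).1
  · intro s hs
    rw [Finset.mem_Ico] at hs
    exact (hg s hs.1 hs.2).2

theorem const_mem (h1 : (fun _ => 1) ∈ A) (c : ℤ) : (fun _ => c) ∈ A := by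
  have := A.zsmul_mem h1 c
  convert this using 1
  funext x
  simp

theorem smul_mem' {l : X → ℤ} (hl : l ∈ A) (c : ℤ) : (fun x => c * l x) ∈ A := by
  have := A.zsmul_mem hl c
  convert this using 1
  funext x
  simp

theorem sub_const_mem (h1 : (fun _ => 1) ∈ A) {l : X → ℤ} (hl : l ∈ A) (c : ℤ) :
    (fun x => l x - c) ∈ A := A.sub_mem hl (const_mem h1 c)

theorem add_const_mem (h1 : (fun _ => 1) ∈ A) {l : X → ℤ} (hl : l ∈ A) (c : ℤ) :
    (fun x => l x + c) ∈ A := A.add_mem hl (const_mem h1 c)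

/-- floors of affine functions -/
def Nice (A : AddSubgroup (X → ℤ)) (m : X → ℤ) : Prop :=
  ∃ l ∈ A, ∃ a : ℤ, 0 < a ∧ m = fun x => l x / a

theorem Nice.of_mem {l : X → ℤ} (hl : l ∈ A) : Nice A l :=
  ⟨l, hl, 1, one_pos, by simp⟩

theorem Nice.cast (h1 : (fun _ => 1) ∈ A) {m : X → ℤ} (hm : Nice A m) :
    (fun x => (m x : ℚ)) ∈ Qalg A := by
  obtain ⟨l, hl, a, ha, rfl⟩ := hm
  refine Qalg.split_mod (l := l) ha (fun r => Qalg.dvd (sub_const_mem h1 hl r) ha) fun r _ _ => ?_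
  refine ⟨_, (Qalg A).smul_mem (Qalg.cast (sub_const_mem h1 hl r)) (1 / (a : ℚ)), fun x hx => ?_⟩
  have := Int.mul_ediv_add_emod (l x) a
  rw [hx] at this
  have h2 : ((l x - r : ℤ) : ℚ) = a * ((l x / a : ℤ) : ℚ) := by
    rw [← Int.cast_mul]; congr 1; linarith
  have : (a : ℚ) ≠ 0 := by positivity
  simp only [Pi.smul_apply, smul_eq_mul, h2]
  field_simp

theorem Nice.dvd (h1 : (fun _ => 1) ∈ A) {m : X → ℤ} (hm : Nice A m) {D : ℤ} (hD : 0 < D) (c : ℤ) :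
    (fun x => ind (D ∣ m x - c)) ∈ Qalg A := by
  obtain ⟨l, hl, a, ha, rfl⟩ := hm
  refine Qalg.split_mod (l := l) ha (fun r => Qalg.dvd (sub_const_mem h1 hl r) ha) fun r _ _ => ?_
  refine ⟨_, Qalg.dvd (sub_const_mem h1 hl (r + a * c)) (mul_pos ha hD), fun x hx => ?_⟩
  have := Int.mul_ediv_add_emod (l x) a
  rw [hx] at this
  have h2 : l x - (r + a * c) = a * (l x / a - c) := by linarith
  apply ind_congr
  simp only [h2]
  exact (mul_dvd_mul_iff_left ha.ne').symm

theorem Nice.le (h1 : (fun _ => 1) ∈ A) {m m' : X → ℤ} (hm : Nice A m) (hm' : Nice A m') :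
    (fun x => ind (m x ≤ m' x)) ∈ Qalg A := by
  obtain ⟨l, hl, a, ha, rfl⟩ := hm
  obtain ⟨l', hl', a', ha', rfl⟩ := hm'
  refine Qalg.split_mod (l := l) ha (fun r => Qalg.dvd (sub_const_mem h1 hl r) ha) fun r _ _ => ?_
  refine ⟨_, Qalg.le (smul_mem' (sub_const_mem h1 hl r) a') (smul_mem' hl' a), fun x hx => ?_⟩
  have := Int.mul_ediv_add_emod (l x) a
  rw [hx] at this
  have h2 : l x - r = a * (l x / a) := by linarith
  apply ind_congr
  simp only [h2]
  rw [Int.le_ediv_iff_mul_le ha', show a' * (a * (l x / a)) = a * (l x / a * a') by ring]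
  exact (mul_le_mul_iff_right₀ ha).symm

theorem Nice.comp (h1 : (fun _ => 1) ∈ A) {m : X → ℤ} (hm : Nice A m) {h : ℕ → ℚ} (hh : QP h)
    (h0 : h 0 = 0) : (fun x => h (m x).toNat) ∈ Qalg A := by
  obtain ⟨D, hD, P, hP⟩ := hh
  have hD' : (0 : ℤ) < D := by exact_mod_cast hD
  refine Qalg.split (Nice.le h1 hm (Nice.of_mem (A.zero_mem))) (g := 0)
    (g' := fun x => (P ((m x % D).toNat)).eval (m x : ℚ)) (Qalg A).zero_mem ?_ ?_ ?_
  · refine Qalg.split_mod (l := m) hD' (fun r => hm.dvd h1 hD' r) fun r _ _ => ?_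
    refine ⟨fun x => (P r.toNat).eval (m x : ℚ), ?_, fun x hx => by simp only [hx]⟩
    generalize P r.toNat = p
    have : (fun x => p.eval (m x : ℚ)) = aeval (fun x => (m x : ℚ)) p := by
      funext x
      have := Polynomial.aeval_algHom_apply (Pi.evalAlgHom ℚ (fun _ : X => ℚ) x) (fun x => (m x : ℚ)) p
      rw [Pi.evalAlgHom_apply, Polynomial.coe_aeval_eq_eval] at this
      exact this
    rw [this]
    exact (Polynomial.aeval_mem_adjoin_singleton ℚ _ |> fun h => (Algebra.adjoin_le
      (Set.singleton_subset_iff.2 (hm.cast h1))) h)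
  · intro x hx
    have : (m x).toNat = 0 := Int.toNat_of_nonpos hx
    simp [this, h0]
  · intro x hx
    have hx : 0 ≤ m x := by
      have : ¬ (m x ≤ 0) := hx
      omega
    rw [hP]
    lift m x to ℕ using hx with k
    norm_cast

end

section
variable {X : Type} {A : AddSubgroup (X → ℤ)}

/-- add one natural variable -/
def extA (A : AddSubgroup (X → ℤ)) : AddSubgroup (X × ℕ → ℤ) where
  carrier := {f | ∃ l ∈ A, ∃ a : ℤ, f = fun p => l p.1 + a * p.2}
  add_mem' := by
    rintro _ _ ⟨l, hl, a, rfl⟩ ⟨l', hl', a', rfl⟩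
    exact ⟨l + l', A.add_mem hl hl', a + a', by funext p; simp; ring⟩
  zero_mem' := ⟨0, A.zero_mem, 0, by funext p; simp⟩
  neg_mem' := by
    rintro _ ⟨l, hl, a, rfl⟩
    exact ⟨-l, A.neg_mem hl, -a, by funext p; simp; ring⟩

def decSet (A : AddSubgroup (X → ℤ)) : Set (X × ℕ → ℚ) :=
  {F | ∃ c ∈ Qalg A, ∃ m, Nice A m ∧ ∃ h, QP h ∧
    F = fun p => c p.1 * h p.2 * ind (m p.1 ≤ p.2)}

def decMod (A : AddSubgroup (X → ℤ)) : Submodule ℚ (X × ℕ → ℚ) := Submodule.span ℚ (decSet A)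

theorem decMod_simple {c : X → ℚ} (hc : c ∈ Qalg A) {h : ℕ → ℚ} (hh : QP h) :
    (fun p : X × ℕ => c p.1 * h p.2) ∈ decMod A := by
  apply Submodule.subset_span
  refine ⟨c, hc, 0, Nice.of_mem A.zero_mem, h, hh, ?_⟩
  funext p
  simp [ind]

theorem decMod_thr {m : X → ℤ} (hm : Nice A m) :
    (fun p : X × ℕ => ind (m p.1 ≤ p.2)) ∈ decMod A := by
  apply Submodule.subset_span
  refine ⟨1, (Qalg A).one_mem, m, hm, 1, QP.const 1, ?_⟩
  funext p
  simp

theorem decMod_mul (h1 : (fun _ => 1) ∈ A) {F G : X × ℕ → ℚ} (hF : F ∈ decMod A) (hG : G ∈ decMod A) :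
    F * G ∈ decMod A := by
  have h : decMod A * decMod A ≤ decMod A := by
    unfold decMod
    rw [Submodule.span_mul_span, Submodule.span_le]
    rintro _ ⟨_, ⟨c, hc, m, hm, h, hh, rfl⟩, _, ⟨c', hc', m', hm', h', hh', rfl⟩, rfl⟩
    have hle := Nice.le h1 hm hm'
    have e : (fun p : X × ℕ => c p.1 * h p.2 * ind (m p.1 ≤ p.2)) *
        (fun p : X × ℕ => c' p.1 * h' p.2 * ind (m' p.1 ≤ p.2)) =
        (fun p : X × ℕ => (ind (m p.1 ≤ m' p.1) * (c p.1 * c' p.1)) * (h p.2 * h' p.2) * ind (m' p.1 ≤ p.2))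
        + (fun p : X × ℕ => (ind (¬ m p.1 ≤ m' p.1) * (c p.1 * c' p.1)) * (h p.2 * h' p.2) * ind (m p.1 ≤ p.2)) := by
      funext p
      simp only [Pi.mul_apply, Pi.add_apply]
      by_cases a : m p.1 ≤ m' p.1
      · rw [ind_true a, ind_false (not_not.2 a)]
        by_cases b : m' p.1 ≤ p.2
        · rw [ind_true b, ind_true (a.trans b)]; ring
        · rw [ind_false b]; ring
      · rw [ind_false a, ind_true a]
        by_cases b : m p.1 ≤ p.2
        · rw [ind_true b, ind_true ((not_le.1 a).le.trans b)]; ring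
        · rw [ind_false b]; ring
    dsimp only
    rw [e]
    apply Submodule.add_mem <;> apply Submodule.subset_span
    · exact ⟨fun x => ind (m x ≤ m' x) * (c x * c' x),
        (Qalg A).mul_mem hle ((Qalg A).mul_mem hc hc'), m', hm', _, hh.mul hh', rfl⟩
    · exact ⟨fun x => ind (¬ m x ≤ m' x) * (c x * c' x),
        (Qalg A).mul_mem (Qalg.not hle) ((Qalg A).mul_mem hc hc'), m, hm, _, hh.mul hh', rfl⟩
  exact h (Submodule.mul_mem_mul hF hG)

theorem decMod_one : (1 : X × ℕ → ℚ) ∈ decMod A := by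
  have := decMod_simple (A := A) (Qalg A).one_mem (QP.const 1)
  convert this using 1
  funext p
  simp

theorem Qalg_le_decMod (h1 : (fun _ => 1) ∈ A) {F : X × ℕ → ℚ} (hF : F ∈ Qalg (extA A)) :
    F ∈ decMod A := by
  have : Qalg (extA A) ≤ (decMod A).toSubalgebra decMod_one (fun _ _ => decMod_mul h1) := by
    apply Algebra.adjoin_le
    rintro _ ((⟨_, ⟨l, hl, a, rfl⟩, rfl⟩ | ⟨_, ⟨l, hl, a, rfl⟩, rfl⟩) | ⟨_, ⟨l, hl, a, rfl⟩, D, hD, rfl⟩)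
    · have e := (decMod A).add_mem (decMod_simple (Qalg.cast hl) (QP.const 1))
        (decMod_simple (Qalg.const (A := A) (a : ℚ)) QP.id)
      show _ ∈ decMod A
      convert e using 1
      funext p
      simp
    · show _ ∈ decMod A
      rcases lt_trichotomy a 0 with ha | rfl | ha
      · have e := (decMod A).sub_mem decMod_one
          (decMod_thr (A := A) ⟨_, add_const_mem h1 hl (-a), -a, by omega, rfl⟩)
        convert e using 1
        funext p
        simp only [Pi.sub_apply, Pi.one_apply]
        rw [← ind_not]
        apply ind_congr
        have hb : 0 < -a := by omega
        rw [← Int.add_one_le_iff.trans not_le.symm, Int.le_ediv_iff_mul_le hb]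
        constructor <;> intro h <;> nlinarith
      · have e := decMod_simple (Qalg.nonneg hl) (QP.const 1)
        convert e using 1
        funext p
        simp
      · have e := decMod_thr (A := A) ⟨_, add_const_mem h1 (A.neg_mem hl) (a - 1), a, ha, rfl⟩
        convert e using 1
        funext p
        apply ind_congr
        dsimp only
        rw [← Int.lt_add_one_iff (b := (p.2 : ℤ)), Int.ediv_lt_iff_lt_mul ha]
        simp only [Pi.neg_apply]
        constructor <;> intro h <;> nlinarith
    · show _ ∈ decMod A
      have e : (fun p : X × ℕ => ind (D ∣ l p.1 + a * p.2)) =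
          ∑ r ∈ Finset.Ico 0 D, fun p : X × ℕ => ind (D ∣ l p.1 - r) * ind (D ∣ a * p.2 + r) := by
        funext p
        rw [Finset.sum_apply, Finset.sum_eq_single (l p.1 % D)]
        · rw [ind_true (Int.dvd_self_sub_emod), one_mul]
          apply ind_congr
          apply dvd_iff_dvd_of_dvd_sub
          have : l p.1 + a * p.2 - (a * p.2 + l p.1 % D) = l p.1 - l p.1 % D := by ring
          rw [this]
          exact Int.dvd_self_sub_emod
        · intro r hr hne
          rw [Finset.mem_Ico] at hr
          rw [ind_false, zero_mul]
          intro hd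
          apply hne
          have := Int.emod_emod_of_dvd r (dvd_refl D)
          rw [Int.emod_eq_emod_iff_emod_sub_eq_zero.2 (Int.emod_eq_zero_of_dvd hd), Int.emod_eq_of_lt hr.1 hr.2]
        · intro h
          exact absurd (by simp [Int.emod_nonneg _ hD.ne', Int.emod_lt_of_pos _ hD]) h
      rw [e]
      exact (decMod A).sum_mem fun r _ => decMod_simple (Qalg.dvd (sub_const_mem h1 hl r) hD)
        (QP.dvd D hD a r)
  exact this hF

theorem Qalg_sum (h1 : (fun _ => 1) ∈ A) (T : X → ℕ) (hT : (fun x => (T x : ℤ)) ∈ A)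
    {F : X × ℕ → ℚ} (hF : F ∈ Qalg (extA A)) :
    (fun x => ∑ y ∈ Finset.range (T x), F (x, y)) ∈ Qalg A := by
  replace hF := Qalg_le_decMod h1 hF
  unfold decMod at hF
  induction hF using Submodule.span_induction with
  | mem F hF =>
    obtain ⟨c, hc, m, hm, h, hh, rfl⟩ := hF
    refine Qalg.split (Nice.le h1 hm (Nice.of_mem hT)) (g := c * ((fun x => ∑ y ∈ Finset.range ((T x : ℤ)).toNat, h y) -
      (fun x => ∑ y ∈ Finset.range (m x).toNat, h y))) (g' := 0) ?_ (Qalg A).zero_mem ?_ ?_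
    · apply (Qalg A).mul_mem hc
      apply (Qalg A).sub_mem
      · exact Nice.comp h1 (Nice.of_mem hT) hh.sum (by simp)
      · exact Nice.comp h1 hm hh.sum (by simp)
    · intro x hx
      have hx' : (m x).toNat ≤ T x := by simpa using hx
      simp only [Pi.mul_apply, Pi.sub_apply, Int.toNat_natCast, mul_assoc, ← Finset.mul_sum]
      congr 1
      rw [← Finset.sum_Ico_eq_sub _ hx', Finset.range_eq_Ico,
        ← Finset.sum_Ico_consecutive _ (Nat.zero_le _) hx']
      rw [Finset.sum_eq_zero, zero_add]
      · apply Finset.sum_congr rfl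
        intro y hy
        rw [Finset.mem_Ico] at hy
        rw [ind_true (by omega), mul_one]
      · intro y hy
        rw [Finset.mem_Ico] at hy
        rw [ind_false (by omega), mul_zero]
    · intro x hx
      apply Finset.sum_eq_zero
      intro y hy
      rw [Finset.mem_range] at hy
      dsimp only
      rw [ind_false, mul_zero]
      omega
  | zero =>
    simp only [Pi.zero_apply, Finset.sum_const_zero]
    exact (Qalg A).zero_mem
  | add F G _ _ hF hG =>
    simp only [Pi.add_apply, Finset.sum_add_distrib]
    exact (Qalg A).add_mem hF hG
  | smul a F _ hF =>
    simp only [Pi.smul_apply, ← Finset.smul_sum]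
    exact (Qalg A).smul_mem hF a

theorem Qalg_comap {Y : Type} {B : AddSubgroup (Y → ℤ)} (e : Y → X) (he : ∀ l ∈ A, (fun y => l (e y)) ∈ B)
    {F : X → ℚ} (hF : F ∈ Qalg A) : (fun y => F (e y)) ∈ Qalg B := by
  unfold Qalg at hF
  induction hF using Algebra.adjoin_induction with
  | mem F hF =>
    rcases hF with (⟨l, hl, rfl⟩ | ⟨l, hl, rfl⟩) | ⟨l, hl, D, hD, rfl⟩
    · exact Qalg.cast (he l hl)
    · exact Qalg.nonneg (he l hl)
    · exact Qalg.dvd (he l hl) hD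
  | algebraMap r => exact Qalg.const r
  | add F G _ _ hF hG => exact (Qalg B).add_mem hF hG
  | mul F G _ _ hF hG => exact (Qalg B).mul_mem hF hG

end

/-- affine functions of `t` and digits indexed by `ι` -/
def affA (ι : Type) [Fintype ι] : AddSubgroup (ℕ × (ι → ℕ) → ℤ) where
  carrier := {f | ∃ a b : ℤ, ∃ c : ι → ℤ, f = fun p => a * p.1 + b + ∑ i, c i * p.2 i}
  add_mem' := by
    rintro _ _ ⟨a, b, c, rfl⟩ ⟨a', b', c', rfl⟩
    refine ⟨a + a', b + b', c + c', ?_⟩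
    funext p; simp [add_mul, Finset.sum_add_distrib]; ring
  zero_mem' := ⟨0, 0, 0, by funext p; simp⟩
  neg_mem' := by
    rintro _ ⟨a, b, c, rfl⟩
    refine ⟨-a, -b, -c, ?_⟩
    funext p; simp; ring

theorem affA_one (ι : Type) [Fintype ι] : (fun _ => 1) ∈ affA ι := ⟨0, 1, 0, by simp⟩
theorem affA_t (ι : Type) [Fintype ι] : (fun p => (p.1 : ℤ)) ∈ affA ι := ⟨1, 0, 0, by simp⟩
theorem affA_dig (ι : Type) [Fintype ι] (i : ι) : (fun p => (p.2 i : ℤ)) ∈ affA ι := by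
  classical
  refine ⟨0, 0, Pi.single i 1, ?_⟩
  funext p
  simp [Pi.single_apply]

/-- eventually quasi-polynomial, rational values -/
def EQ (f : ℕ → ℚ) : Prop := ∃ h, QP h ∧ ∃ N, ∀ t, N ≤ t → f t = h t

theorem Qalg_base {F : ℕ × (Fin 0 → ℕ) → ℚ} (hF : F ∈ Qalg (affA (Fin 0))) :
    EQ (fun t => F (t, Fin.elim0)) := by
  unfold Qalg at hF
  induction hF using Algebra.adjoin_induction with
  | mem F hF =>
    rcases hF with (⟨_, ⟨a, b, c, rfl⟩, rfl⟩ | ⟨_, ⟨a, b, c, rfl⟩, rfl⟩) | ⟨_, ⟨a, b, c, rfl⟩, D, hD, rfl⟩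
    · refine ⟨_, ((QP.const a).mul QP.id).add (QP.const b), 0, fun t _ => ?_⟩
      simp
    · rcases lt_trichotomy a 0 with ha | rfl | ha
      · refine ⟨_, QP.const 0, (|b| + 1).toNat, fun t ht => ?_⟩
        dsimp only
        rw [ind_false]
        have : |b| + 1 ≤ t := by omega
        have := le_abs_self b
        simp
        nlinarith
      · refine ⟨_, QP.const (ind (0 ≤ b)), 0, fun t ht => ?_⟩
        simp
      · refine ⟨_, QP.const 1, (|b| + 1).toNat, fun t ht => ?_⟩
        dsimp only
        rw [ind_true]
        have : |b| + 1 ≤ t := by omega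
        have := neg_abs_le b
        simp
        nlinarith
    · refine ⟨_, QP.dvd D hD a b, 0, fun t _ => ?_⟩
      simp
  | algebraMap r => exact ⟨_, QP.const r, 0, fun t _ => rfl⟩
  | add F G _ _ hF hG =>
    obtain ⟨h, hh, N, hN⟩ := hF
    obtain ⟨h', hh', N', hN'⟩ := hG
    refine ⟨_, hh.add hh', max N N', fun t ht => ?_⟩
    simp [hN t (by omega), hN' t (by omega)]
  | mul F G _ _ hF hG =>
    obtain ⟨h, hh, N, hN⟩ := hF
    obtain ⟨h', hh', N', hN'⟩ := hG
    refine ⟨_, hh.mul hh', max N N', fun t ht => ?_⟩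
    simp [hN t (by omega), hN' t (by omega)]

theorem Qalg_count_fin (n : ℕ) {F : ℕ × (Fin n → ℕ) → ℚ} (hF : F ∈ Qalg (affA (Fin n))) :
    EQ (fun t => ∑ d : Fin n → Fin t, F (t, fun i => (d i : ℕ))) := by
  induction n with
  | zero =>
    convert Qalg_base hF using 2 with t
    simp
    congr 2
    funext i
    exact i.elim0
  | succ n ih =>
    have h2 : (fun p : (ℕ × (Fin n → ℕ)) × ℕ => F (p.1.1, Fin.cons p.2 p.1.2)) ∈ Qalg (extA (affA (Fin n))) := by
      refine Qalg_comap (A := affA (Fin (n+1))) (fun p : (ℕ × (Fin n → ℕ)) × ℕ => (p.1.1, Fin.cons p.2 p.1.2)) ?_ hF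
      rintro _ ⟨a, b, c, rfl⟩
      refine ⟨_, ⟨a, b, fun i => c i.succ, rfl⟩, c 0, ?_⟩
      funext p
      simp [Fin.sum_univ_succ]
      ring
    have h3 := Qalg_sum (affA_one _) (fun p => p.1) (affA_t _) h2
    convert ih h3 using 2 with t
    rw [← (Fin.consEquiv (fun _ : Fin (n+1) => Fin t)).sum_comp, Fintype.sum_prod_type_right]
    apply Finset.sum_congr rfl
    intro d _
    dsimp only
    rw [← Fin.sum_univ_eq_sum_range (fun y => F (t, Fin.cons y fun i => (d i : ℕ)))]
    apply Finset.sum_congr rfl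
    intro y _
    congr 2
    funext i
    refine Fin.cases ?_ (fun j => ?_) i <;> simp [Fin.consEquiv]

theorem Qalg_count (ι : Type) [Fintype ι] [DecidableEq ι] {F : ℕ × (ι → ℕ) → ℚ} (hF : F ∈ Qalg (affA ι)) :
    EQ (fun t => ∑ d : ι → Fin t, F (t, fun i => (d i : ℕ))) := by
  let e := Fintype.equivFin ι
  have h2 : (fun p : ℕ × (Fin (Fintype.card ι) → ℕ) => F (p.1, fun i => p.2 (e i))) ∈ Qalg (affA (Fin (Fintype.card ι))) := by
    refine Qalg_comap (A := affA ι) (fun p : ℕ × (Fin (Fintype.card ι) → ℕ) => (p.1, fun i => p.2 (e i))) ?_ hF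
    rintro _ ⟨a, b, c, rfl⟩
    refine ⟨a, b, fun i => c (e.symm i), ?_⟩
    funext p
    simp only
    congr 1
    rw [← e.sum_comp]
    simp
  convert Qalg_count_fin _ h2 using 2 with t
  rw [← (Equiv.arrowCongr e (Equiv.refl (Fin t))).sum_comp]
  simp

section
variable {X : Type} {A : AddSubgroup (X → ℤ)} {t : X → ℤ}

/-- polynomials in `t` with affine coefficients -/
inductive TT (A : AddSubgroup (X → ℤ)) (t : X → ℤ) : (X → ℤ) → Prop
  | base (l : X → ℤ) (hl : l ∈ A) : TT A t l
  | step (l f : X → ℤ) (hl : l ∈ A) (hf : TT A t f) : TT A t (fun x => l x + t x * f x)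

theorem TT.add {f g : X → ℤ} (hf : TT A t f) (hg : TT A t g) : TT A t (fun x => f x + g x) := by
  induction hf generalizing g with
  | base l hl =>
    cases hg with
    | base l' hl' => exact TT.base _ (A.add_mem hl hl')
    | step l' f hl' hf =>
      convert TT.step (l + l') f (A.add_mem hl hl') hf using 2 with x
      simp; ring
  | step l f hl hf ih =>
    cases hg with
    | base _ hl' =>
      convert TT.step (l + g) f (A.add_mem hl hl') hf using 2 with x
      simp; ring
    | step l' f' hl' hf' =>
      convert TT.step (l + l') _ (A.add_mem hl hl') (ih hf') using 2 with x
      simp; ring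

theorem TT.sum {κ : Type} (s : Finset κ) (f : κ → X → ℤ) (hf : ∀ i ∈ s, TT A t (f i)) :
    TT A t (fun x => ∑ i ∈ s, f i x) := by
  classical
  induction s using Finset.induction_on with
  | empty => exact TT.base _ A.zero_mem
  | insert a s ha ih =>
    simp only [Finset.sum_insert ha]
    exact TT.add (hf a (by simp)) (ih fun i hi => hf i (by simp [hi]))

theorem TT.poly (p : ℤ[X]) {l : X → ℤ} (hl : l ∈ A) : TT A t (fun x => p.eval (t x) * l x) := by
  induction p using Polynomial.induction_on' with
  | add p q hp hq =>
    convert TT.add hp hq using 2 with x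
    simp; ring
  | monomial k a =>
    induction k with
    | zero =>
      convert TT.base (t := t) _ (smul_mem' hl a) using 2 with x
      simp
    | succ k ih =>
      convert TT.step 0 _ A.zero_mem ih using 2 with x
      simp; ring

theorem TT.sign (h1 : (fun _ => 1) ∈ A) (ht : t ∈ A) (Dom : Set X) (hpos : ∀ x ∈ Dom, 0 < t x)
    (hbd : ∀ l ∈ A, ∃ C : ℤ, ∀ x ∈ Dom, |l x| ≤ C * t x) {f : X → ℤ} (hf : TT A t f) :
    ∀ k : ℤ, ∃ F ∈ Qalg A, ∀ x ∈ Dom, F x = ind (f x + k ≤ 0) := by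
  induction hf with
  | base l hl =>
    intro k
    exact ⟨_, Qalg.le (add_const_mem h1 hl k) A.zero_mem, fun x _ => rfl⟩
  | step l f hl hf ih =>
    intro k
    choose F hF hF' using ih
    have hl' := add_const_mem h1 hl k
    obtain ⟨C, hC⟩ := hbd _ hl'
    refine ⟨∑ j ∈ Finset.Icc (-C) C, (fun x => ind (¬ (l x + k ≤ (j - 1) * t x) ∧ l x + k ≤ j * t x)) * F j,
      (Qalg A).sum_mem fun j _ => (Qalg A).mul_mem (Qalg.and (Qalg.not (Qalg.le hl' (smul_mem' ht (j-1))))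
        (Qalg.le hl' (smul_mem' ht j))) (hF j), ?_⟩
    intro x hx
    have htx := hpos x hx
    have hCx := abs_le.1 (hC x hx)
    set j0 : ℤ := -((-(l x + k)) / t x) with hj0
    have e1 := Int.mul_ediv_add_emod (-(l x + k)) (t x)
    have e2 := Int.emod_nonneg (-(l x + k)) htx.ne'
    have e3 := Int.emod_lt_of_pos (-(l x + k)) htx
    generalize (-(l x + k)) % t x = r at e1 e2 e3
    have e4 : (-(l x + k)) / t x = - j0 := by omega
    rw [e4] at e1
    clear_value j0
    rw [Finset.sum_apply, Finset.sum_eq_single j0]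
    · rw [Pi.mul_apply, ind_true, one_mul, hF' _ _ hx]
      · apply ind_congr
        constructor
        · intro h
          nlinarith
        · intro h
          by_contra h'
          push Not at h'
          have : 1 ≤ f x + j0 := by omega
          nlinarith
      · constructor <;> nlinarith
    · intro j _ hj
      rw [Pi.mul_apply, ind_false, zero_mul]
      rintro ⟨h2, h3⟩
      apply hj
      push Not at h2
      apply le_antisymm
      · by_contra h
        have : j0 ≤ j - 1 := by omega
        nlinarith
      · by_contra h
        have : j ≤ j0 - 1 := by omega
        nlinarith
    · intro h
      exfalso
      apply h
      rw [Finset.mem_Icc]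
      constructor
      · by_contra h
        have : j0 ≤ - C - 1 := by omega
        nlinarith
      · by_contra h
        have : C ≤ j0 - 1 := by omega
        nlinarith

end

theorem affA_bdd (ι : Type) [Fintype ι] (l : ℕ × (ι → ℕ) → ℤ) (hl : l ∈ affA ι) :
    ∃ C : ℤ, ∀ x ∈ {p : ℕ × (ι → ℕ) | 0 < p.1 ∧ ∀ i, p.2 i < p.1}, |l x| ≤ C * (x.1 : ℤ) := by
  obtain ⟨a, b, c, rfl⟩ := hl
  refine ⟨|a| + |b| + ∑ i, |c i|, ?_⟩
  rintro ⟨t, d⟩ ⟨ht, hd⟩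
  dsimp only at ht hd ⊢
  have ht' : (1 : ℤ) ≤ t := by exact_mod_cast ht
  have hs : |∑ i, c i * (d i : ℤ)| ≤ (∑ i, |c i|) * t := by
    rw [Finset.sum_mul]
    refine (Finset.abs_sum_le_sum_abs _ _).trans (Finset.sum_le_sum fun i _ => ?_)
    rw [abs_mul]
    apply mul_le_mul_of_nonneg_left _ (abs_nonneg _)
    rw [abs_of_nonneg (by positivity)]
    exact_mod_cast (hd i).le
  have h1 := abs_add_le (a * t + b) (∑ i, c i * (d i : ℤ))
  have h2 := abs_add_le (a * (t : ℤ)) b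
  rw [abs_mul, abs_of_nonneg (by positivity : (0 : ℤ) ≤ t)] at h2
  have h3 : |b| ≤ |b| * t := by nlinarith [abs_nonneg b]
  nlinarith

section FM
open Filter

/-- real value of an integer polynomial at a natural -/
noncomputable def ev (p : ℤ[X]) (t : ℕ) : ℝ := ((p.eval (t : ℤ) : ℤ) : ℝ)

theorem ev_add (p q : ℤ[X]) (t : ℕ) : ev (p + q) t = ev p t + ev q t := by simp [ev]
theorem ev_mul (p q : ℤ[X]) (t : ℕ) : ev (p * q) t = ev p t * ev q t := by simp [ev]
theorem ev_neg (p : ℤ[X]) (t : ℕ) : ev (-p) t = - ev p t := by simp [ev]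
theorem ev_zero (t : ℕ) : ev 0 t = 0 := by simp [ev]

theorem ev_pos_ge_one {p : ℤ[X]} {t : ℕ} (h : 0 < ev p t) : 1 ≤ ev p t := by
  unfold ev at *
  have : 0 < p.eval (t : ℤ) := by exact_mod_cast h
  exact_mod_cast this

theorem ev_pos_of_lead {p : ℤ[X]} (h : 0 < p.leadingCoeff) : ∀ᶠ t : ℕ in atTop, 0 < ev p t := by
  have hev : ∀ t : ℕ, ev p t = (p.map (Int.castRingHom ℝ)).eval (t : ℝ) := by
    intro t
    have := Polynomial.eval_map_apply (Int.castRingHom ℝ) (p := p) (x := (t : ℤ))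
    simp only [eq_intCast, Int.cast_natCast] at this
    rw [this]; rfl
  have hl : (p.map (Int.castRingHom ℝ)).leadingCoeff = (p.leadingCoeff : ℝ) := by
    rw [Polynomial.leadingCoeff_map_of_injective (Int.cast_injective)]
    simp
  by_cases hd : 0 < (p.map (Int.castRingHom ℝ)).degree
  · have := Polynomial.tendsto_atTop_of_leadingCoeff_nonneg _ hd (by rw [hl]; exact_mod_cast h.le)
    have := (this.comp tendsto_natCast_atTop_atTop).eventually_gt_atTop 0
    filter_upwards [this] with t ht
    rw [hev]
    exact ht
  · have hc := Polynomial.eq_C_of_degree_le_zero (not_lt.1 hd)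
    filter_upwards with t
    rw [hev, hc, eval_C]
    rw [hc, leadingCoeff_C] at hl
    rw [hl]
    exact_mod_cast h

theorem ev_sign (p : ℤ[X]) : (∀ᶠ t : ℕ in atTop, 0 < ev p t) ∨ p = 0 ∨ (∀ᶠ t : ℕ in atTop, 0 < ev (-p) t) := by
  rcases lt_trichotomy p.leadingCoeff 0 with h | h | h
  · right; right
    apply ev_pos_of_lead
    simpa using h
  · right; left
    simpa using h
  · left
    exact ev_pos_of_lead h

/-- polynomially bounded -/
def PB (f : ℕ → ℝ) : Prop := ∃ K : ℕ, ∀ᶠ t : ℕ in atTop, f t ≤ (t : ℝ) ^ K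

theorem pow_le_aux {t : ℕ} (ht : 2 ≤ t) {K L : ℕ} (h : K ≤ L) : (t : ℝ) ^ K ≤ (t : ℝ) ^ L := by
  apply pow_le_pow_right₀ _ h
  have : (2 : ℝ) ≤ t := by exact_mod_cast ht
  linarith

theorem PB.add {f g : ℕ → ℝ} (hf : PB f) (hg : PB g) : PB (fun t => f t + g t) := by
  obtain ⟨K, hK⟩ := hf
  obtain ⟨L, hL⟩ := hg
  refine ⟨max K L + 1, ?_⟩
  filter_upwards [hK, hL, eventually_ge_atTop 2] with t h1 h2 ht
  have h3 := pow_le_aux ht (le_max_left K L)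
  have h4 := pow_le_aux ht (le_max_right K L)
  have : (2 : ℝ) ≤ t := by exact_mod_cast ht
  rw [pow_succ]
  have : (0 : ℝ) ≤ (t : ℝ) ^ max K L := by positivity
  nlinarith

theorem PB.mul_pow {f : ℕ → ℝ} (hf : PB f) (L : ℕ) : PB (fun t => f t * (t : ℝ) ^ L) := by
  obtain ⟨K, hK⟩ := hf
  refine ⟨K + L, ?_⟩
  filter_upwards [hK] with t h1
  rw [pow_add]
  gcongr

theorem PB.sum {κ : Type} (s : Finset κ) (f : κ → ℕ → ℝ) (hf : ∀ i ∈ s, PB (f i)) :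
    PB (fun x => ∑ i ∈ s, f i x) := by
  classical
  induction s using Finset.induction_on with
  | empty => exact ⟨0, by simp⟩
  | insert a s ha ih =>
    simp only [Finset.sum_insert ha]
    exact PB.add (hf a (by simp)) (ih fun i hi => hf i (by simp [hi]))

theorem PB.mono {f g : ℕ → ℝ} (hg : PB g) (h : ∀ t, f t ≤ g t) : PB f := by
  obtain ⟨K, hK⟩ := hg
  refine ⟨K, ?_⟩
  filter_upwards [hK] with t h1
  exact (h t).trans h1

theorem PB.ev (p : ℤ[X]) : PB (fun t => |ev p t|) := by
  induction p using Polynomial.induction_on' with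
  | add p q hp hq =>
    refine (hp.add hq).mono fun t => ?_
    rw [ev_add]
    exact abs_add_le _ _
  | monomial k a =>
    refine ⟨k + 1, ?_⟩
    filter_upwards [eventually_ge_atTop a.natAbs] with t ht
    have : |(a : ℝ)| ≤ t := by
      rw [← Int.cast_abs, Int.abs_eq_natAbs]
      exact_mod_cast ht
    simp only [_root_.ev, eval_monomial, Int.cast_mul, Int.cast_pow, Int.cast_natCast, abs_mul, abs_pow, Nat.abs_cast]
    rw [pow_succ, mul_comm]
    gcongr

abbrev PCon (n : ℕ) := (Fin n → ℤ[X]) × ℤ[X]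

def Sat {n : ℕ} (S : List (PCon n)) (t : ℕ) (x : Fin n → ℝ) : Prop :=
  ∀ c ∈ S, ∑ j, ev (c.1 j) t * x j ≤ ev c.2 t

theorem exists_between_lists (lo hi : List ℝ) (h : ∀ l ∈ lo, ∀ u ∈ hi, l ≤ u) :
    ∃ x, (∀ l ∈ lo, l ≤ x) ∧ ∀ u ∈ hi, x ≤ u := by
  classical
  by_cases hlo : lo.toFinset.Nonempty
  · refine ⟨lo.toFinset.max' hlo, fun l hl => Finset.le_max' _ _ (by simpa using hl), fun u hu => ?_⟩
    apply h _ _ u hu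
    simpa using Finset.max'_mem _ hlo
  · have : lo = [] := by simpa using hlo
    subst this
    by_cases hhi : hi.toFinset.Nonempty
    · exact ⟨hi.toFinset.min' hhi, by simp, fun u hu => Finset.min'_le _ _ (by simpa using hu)⟩
    · have : hi = [] := by simpa using hhi
      subst this
      exact ⟨0, by simp, by simp⟩

/-- combination of two constraints eliminating the first variable -/
noncomputable def comb {n : ℕ} (c c' : PCon (n + 1)) : PCon n :=
  (fun j => (- c'.1 0) * c.1 j.succ + c.1 0 * c'.1 j.succ, (- c'.1 0) * c.2 + c.1 0 * c'.2)

theorem FM_step {n : ℕ} (S : List (PCon (n + 1))) : ∃ S' : List (PCon n), ∀ᶠ t : ℕ in atTop,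
    ∀ x' : Fin n → ℝ, (∃ x0 : ℝ, Sat S t (Fin.cons x0 x')) ↔ Sat S' t x' := by
  classical
  let P : List (PCon (n+1)) := S.filter fun c => ∀ᶠ t : ℕ in atTop, 0 < ev (c.1 0) t
  let N : List (PCon (n+1)) := S.filter fun c => ∀ᶠ t : ℕ in atTop, 0 < ev (-c.1 0) t
  let Z : List (PCon (n+1)) := S.filter fun c => c.1 0 = 0
  have hPm : ∀ c, c ∈ P ↔ c ∈ S ∧ ∀ᶠ t : ℕ in atTop, 0 < ev (c.1 0) t := by simp [P]
  have hNm : ∀ c, c ∈ N ↔ c ∈ S ∧ ∀ᶠ t : ℕ in atTop, 0 < ev (-c.1 0) t := by simp [N]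
  have hZm : ∀ c, c ∈ Z ↔ c ∈ S ∧ c.1 0 = 0 := by simp [Z]
  have hP : ∀ᶠ t : ℕ in atTop, ∀ c ∈ P, 0 < ev (c.1 0) t := by
    have := (Filter.eventually_all_finset (l := atTop) P.toFinset (p := fun c t => 0 < ev (c.1 0) t)).2
      (fun c hc => ((hPm c).1 (by simpa using hc)).2)
    filter_upwards [this] with t ht c hc using ht c (by simpa using hc)
  have hN : ∀ᶠ t : ℕ in atTop, ∀ c ∈ N, 0 < ev (-c.1 0) t := by
    have := (Filter.eventually_all_finset (l := atTop) N.toFinset (p := fun c t => 0 < ev (-c.1 0) t)).2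
      (fun c hc => ((hNm c).1 (by simpa using hc)).2)
    filter_upwards [this] with t ht c hc using ht c (by simpa using hc)
  refine ⟨Z.map (fun c => (fun j => c.1 j.succ, c.2)) ++ P.flatMap (fun c => N.map (comb c)), ?_⟩
  filter_upwards [hP, hN] with t hP hN x'
  have hcomb : ∀ c c' : PCon (n+1), (∑ j, ev ((comb c c').1 j) t * x' j ≤ ev (comb c c').2 t) ↔
      ev (-c'.1 0) t * (∑ j : Fin n, ev (c.1 j.succ) t * x' j) + ev (c.1 0) t * (∑ j : Fin n, ev (c'.1 j.succ) t * x' j)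
      ≤ ev (-c'.1 0) t * ev c.2 t + ev (c.1 0) t * ev c'.2 t := by
    intro c c'
    simp only [comb, ev_add, ev_mul, add_mul, Finset.sum_add_distrib, mul_assoc, Finset.mul_sum]
  constructor
  · rintro ⟨x0, hx⟩ d hd
    rw [List.mem_append, List.mem_map, List.mem_flatMap] at hd
    rcases hd with ⟨c, hc, rfl⟩ | ⟨c, hc, hd⟩
    · have := hx c ((hZm c).1 hc).1
      rw [Fin.sum_univ_succ, ((hZm c).1 hc).2] at this
      simpa [ev_zero] using this
    · rw [List.mem_map] at hd
      obtain ⟨c', hc', rfl⟩ := hd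
      rw [hcomb]
      have h1 := hx c ((hPm c).1 hc).1
      have h2 := hx c' ((hNm c').1 hc').1
      have h3 := hP c hc
      have h4 := hN c' hc'
      rw [Fin.sum_univ_succ] at h1 h2
      simp only [Fin.cons_zero, Fin.cons_succ] at h1 h2
      have h5 := mul_le_mul_of_nonneg_left h1 h4.le
      have h6 := mul_le_mul_of_nonneg_left h2 h3.le
      rw [ev_neg] at *
      nlinarith
  · intro hx
    obtain ⟨x0, hlo, hhi⟩ := exists_between_lists
      (N.map fun c => (∑ j : Fin n, ev (c.1 j.succ) t * x' j - ev c.2 t) / ev (-c.1 0) t)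
      (P.map fun c => (ev c.2 t - ∑ j : Fin n, ev (c.1 j.succ) t * x' j) / ev (c.1 0) t) (by
        intro l hl u hu
        rw [List.mem_map] at hl hu
        obtain ⟨c', hc', rfl⟩ := hl
        obtain ⟨c, hc, rfl⟩ := hu
        rw [div_le_div_iff₀ (hN c' hc') (hP c hc)]
        have := hx (comb c c') (by
          rw [List.mem_append]
          right
          rw [List.mem_flatMap]
          exact ⟨c, hc, List.mem_map_of_mem hc'⟩)
        rw [hcomb] at this
        linarith)
    refine ⟨x0, fun c hc => ?_⟩
    rw [Fin.sum_univ_succ]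
    simp only [Fin.cons_zero, Fin.cons_succ]
    rcases ev_sign (c.1 0) with h | h | h
    · have hc' : c ∈ P := (hPm c).2 ⟨hc, h⟩
      have := hhi _ (List.mem_map_of_mem hc')
      rw [le_div_iff₀ (hP c hc')] at this
      linarith
    · have hc' : c ∈ Z := (hZm c).2 ⟨hc, h⟩
      have := hx (fun j => c.1 j.succ, c.2) (by
        rw [List.mem_append]; left
        exact List.mem_map.2 ⟨c, hc', rfl⟩)
      rw [h, ev_zero]
      simpa using this
    · have hc' : c ∈ N := (hNm c).2 ⟨hc, h⟩
      have := hlo _ (List.mem_map_of_mem hc')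
      rw [div_le_iff₀ (hN c hc'), ev_neg] at this
      linarith

theorem upper_bound {n : ℕ} (S : List (PCon (n + 1))) (K : ℕ) (ε : ℤ) (hε : ε = 1 ∨ ε = -1)
    (hbd : ∀ᶠ t : ℕ in atTop, ∃ R : ℝ, ∀ x, Sat S t x → ∀ i, |x i| ≤ R)
    (hK : ∀ᶠ t : ℕ in atTop, ∀ x, Sat S t x → ∀ i : Fin n, |x i.succ| ≤ (t : ℝ) ^ K) :
    ∃ L : ℕ, ∀ᶠ t : ℕ in atTop, ∀ x, Sat S t x → ε * x 0 ≤ (t : ℝ) ^ L := by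
  have hεe : ∀ p t, ev (C ε * p) t = ε * ev p t := by intro p t; simp [ev]
  have hε2 : (ε : ℝ) * ε = 1 := by rcases hε with rfl | rfl <;> simp
  by_cases hex : ∃ c ∈ S, ∀ᶠ t : ℕ in atTop, 0 < ev (C ε * c.1 0) t
  · obtain ⟨c, hc, hpos⟩ := hex
    obtain ⟨L, hL⟩ := (PB.ev c.2).add (PB.sum Finset.univ (fun (j : Fin n) t => |ev (c.1 j.succ) t| * (t : ℝ) ^ K)
      (fun j _ => (PB.ev _).mul_pow K))
    refine ⟨L, ?_⟩
    filter_upwards [hL, hpos, hK] with t hL hpos hK x hx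
    refine le_trans ?_ hL
    have h1 := ev_pos_ge_one hpos
    rw [hεe] at h1
    have h2 := hx c hc
    rw [Fin.sum_univ_succ] at h2
    have h3 : - ∑ j : Fin n, |ev (c.1 j.succ) t| * (t : ℝ) ^ K ≤ ∑ j : Fin n, ev (c.1 j.succ) t * x j.succ := by
      rw [← Finset.sum_neg_distrib]
      apply Finset.sum_le_sum
      intro j _
      have := neg_abs_le (ev (c.1 j.succ) t * x j.succ)
      rw [abs_mul] at this
      have := mul_le_mul_of_nonneg_left (hK x hx j) (abs_nonneg (ev (c.1 j.succ) t))
      linarith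
    have h4 := le_abs_self (ev c.2 t)
    have h5 : ε * ev (c.1 0) t * (ε * x 0) = ev (c.1 0) t * x 0 := by
      linear_combination (ev (c.1 0) t * x 0) * hε2
    have h6 : 0 ≤ ∑ j : Fin n, |ev (c.1 j.succ) t| * (t : ℝ) ^ K := Finset.sum_nonneg fun j _ => by positivity
    have h7 := abs_nonneg (ev c.2 t)
    by_cases h8 : (ε : ℝ) * x 0 ≤ 0
    · linarith
    · nlinarith
  · push Not at hex
    have hneg : ∀ᶠ t : ℕ in atTop, ∀ c ∈ S, ev (C ε * c.1 0) t ≤ 0 := by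
      classical
      have := (Filter.eventually_all_finset (l := atTop) S.toFinset (p := fun c t => ev (C ε * c.1 0) t ≤ 0)).2
        (fun c hc => by
          rcases ev_sign (C ε * c.1 0) with h | h | h
          · exact absurd h (by
              rw [Filter.not_eventually]
              simpa only [not_lt] using hex c (by simpa using hc))
          · rw [h]; simp [ev_zero]
          · filter_upwards [h] with t ht
            rw [ev_neg] at ht
            linarith)
      filter_upwards [this] with t ht c hc using ht c (by simpa using hc)
    refine ⟨0, ?_⟩
    filter_upwards [hneg, hbd] with t hneg hbd x hx
    exfalso
    obtain ⟨R, hR⟩ := hbd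
    have h0 := hR x hx 0
    have hR0 : 0 ≤ R := (abs_nonneg _).trans h0
    have hy : Sat S t (x + Pi.single 0 (ε * (2 * R + 1))) := by
      intro c hc
      have := hx c hc
      have h2 := hneg c hc
      rw [hεe] at h2
      rw [Fin.sum_univ_succ] at this ⊢
      simp [Fin.succ_ne_zero]
      nlinarith
    have h1 := hR _ hy 0
    simp at h1
    rw [abs_le] at h0 h1
    rcases hε with rfl | rfl <;> simp at h1 <;> linarith

theorem poly_bound (n : ℕ) (S : List (PCon n))
    (hbd : ∀ᶠ t : ℕ in atTop, ∃ R : ℝ, ∀ x, Sat S t x → ∀ i, |x i| ≤ R) :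
    ∃ K : ℕ, ∀ᶠ t : ℕ in atTop, ∀ x, Sat S t x → ∀ i, |x i| ≤ (t : ℝ) ^ K := by
  induction n with
  | zero => exact ⟨0, by filter_upwards with t x _ i using i.elim0⟩
  | succ n ih =>
    obtain ⟨S', hS'⟩ := FM_step S
    obtain ⟨K, hK⟩ := ih S' (by
      filter_upwards [hS', hbd] with t h1 ⟨R, hR⟩
      refine ⟨R, fun x hx i => ?_⟩
      obtain ⟨x0, h⟩ := (h1 x).2 hx
      simpa using hR _ h i.succ)
    have hK' : ∀ᶠ t : ℕ in atTop, ∀ x, Sat S t x → ∀ i : Fin n, |x i.succ| ≤ (t : ℝ) ^ K := by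
      filter_upwards [hS', hK] with t h1 h2 x hx i
      have : Sat S' t (Fin.tail x) := (h1 _).1 ⟨x 0, by rwa [Fin.cons_self_tail]⟩
      exact h2 _ this i
    obtain ⟨L, hL⟩ := upper_bound S K 1 (Or.inl rfl) hbd hK'
    obtain ⟨M, hM⟩ := upper_bound S K (-1) (Or.inr rfl) hbd hK'
    refine ⟨max K (max L M), ?_⟩
    filter_upwards [hK', hL, hM, eventually_ge_atTop 2] with t h1 h2 h3 ht x hx i
    refine Fin.cases ?_ (fun j => ?_) i
    · have h2 := h2 x hx
      have h3 := h3 x hx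
      have h4 := pow_le_aux ht (show L ≤ max K (max L M) by simp)
      have h5 := pow_le_aux ht (show M ≤ max K (max L M) by simp)
      simp at h2 h3
      rw [abs_le]
      constructor <;> linarith
    · exact (h1 x hx j).trans (pow_le_aux ht (by simp))

end FM

/-- decoding shifted base-`t` digits -/
def dec (n J K t : ℕ) (d : Fin n × Fin J → ℕ) : Fin n → ℤ :=
  fun i => ∑ k : Fin J, (d (i, k) : ℤ) * (t : ℤ) ^ (k : ℕ) - (t : ℤ) ^ K

theorem dec_inj (n J K t : ℕ) :
    Function.Injective (fun d : Fin n × Fin J → Fin t => dec n J K t (fun p => (d p : ℕ))) := by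
  intro d d' h
  have key : ∀ i, (fun k => d (i, k)) = (fun k => d' (i, k)) := by
    intro i
    apply (finFunctionFinEquiv (m := t) (n := J)).injective
    apply Fin.ext
    rw [finFunctionFinEquiv_apply, finFunctionFinEquiv_apply]
    have := congrFun h i
    simp only [dec, sub_left_inj] at this
    exact_mod_cast this
  funext ⟨i, k⟩
  exact congrFun (key i) k

theorem dec_surj (n J K t : ℕ) (x : Fin n → ℤ) (h0 : ∀ i, 0 ≤ x i + (t : ℤ) ^ K)
    (h1 : ∀ i, x i + (t : ℤ) ^ K < (t : ℤ) ^ J) :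
    ∃ d : Fin n × Fin J → Fin t, dec n J K t (fun p => (d p : ℕ)) = x := by
  have : ∀ i, ∃ f : Fin J → Fin t, ∑ k : Fin J, ((f k : ℕ) : ℤ) * (t : ℤ) ^ (k : ℕ) = x i + (t : ℤ) ^ K := by
    intro i
    obtain ⟨y, hy⟩ := Int.eq_ofNat_of_zero_le (h0 i)
    have hlt : y < t ^ J := by
      have := h1 i
      rw [hy] at this
      exact_mod_cast this
    refine ⟨finFunctionFinEquiv.symm ⟨y, hlt⟩, ?_⟩
    have h := finFunctionFinEquiv_apply (finFunctionFinEquiv.symm (⟨y, hlt⟩ : Fin (t ^ J)))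
    rw [Equiv.apply_symm_apply] at h
    rw [hy]
    simp only at h
    exact_mod_cast h.symm
  choose f hf using this
  refine ⟨fun p => f p.1 p.2, ?_⟩
  funext i
  simp [dec, hf]

theorem con_TT (n J K : ℕ) (a : Fin n → ℤ[X]) (b : ℤ[X]) :
    TT (affA (Fin n × Fin J)) (fun p => (p.1 : ℤ))
      (fun p => ∑ j, evalAt (a j) p.1 * dec n J K p.1 p.2 j - evalAt b p.1) := by
  have h1 := TT.add (TT.sum Finset.univ (fun (j : Fin n) (p : ℕ × (Fin n × Fin J → ℕ)) =>
      ∑ k : Fin J, (a j * X ^ (k : ℕ)).eval (p.1 : ℤ) * (p.2 (j, k) : ℤ))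
      (fun j _ => TT.sum Finset.univ _ (fun k _ => TT.poly (A := affA (Fin n × Fin J)) (t := fun p => (p.1 : ℤ)) _ (affA_dig _ (j, k)))))
    (TT.poly (A := affA (Fin n × Fin J)) (t := fun p => (p.1 : ℤ)) (- (∑ j, a j * X ^ K) - b) (affA_one _))
  convert h1 using 2 with p
  simp only [dec, evalAt, eval_mul, eval_pow, eval_X, eval_sub, eval_neg, eval_finsetSum, mul_sub,
    Finset.sum_sub_distrib, Finset.mul_sum, mul_one]
  rw [show ∀ a b c d : ℤ, a = d → a - b - c = d + (-b - c) from fun a b c d h => by rw [h]; ring]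
  apply Finset.sum_congr rfl fun j _ => Finset.sum_congr rfl fun k _ => by ring

theorem count_eq (n m J K : ℕ) (A : Matrix (Fin m) (Fin n) (Polynomial ℤ)) (b : Fin m → Polynomial ℤ) :
    EQ (fun t => ∑ d : Fin n × Fin J → Fin t,
      ind (∀ i, ∑ j, evalAt (A i j) t * dec n J K t (fun p => (d p : ℕ)) j ≤ evalAt (b i) t)) := by
  have h : ∀ i, ∃ F ∈ Qalg (affA (Fin n × Fin J)), ∀ x ∈ {p : ℕ × (Fin n × Fin J → ℕ) | 0 < p.1 ∧ ∀ i, p.2 i < p.1},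
      F x = ind (∑ j, evalAt (A i j) x.1 * dec n J K x.1 x.2 j - evalAt (b i) x.1 + 0 ≤ 0) := fun i =>
    TT.sign (affA_one _) (affA_t _) _ (fun x hx => by exact_mod_cast hx.1) (affA_bdd _)
      (con_TT n J K (A i) (b i)) 0
  choose F hF hF' using h
  obtain ⟨h, hh, N, hN⟩ := Qalg_count _ ((Qalg (affA (Fin n × Fin J))).prod_mem (t := Finset.univ) fun i _ => hF i)
  refine ⟨h, hh, max N 1, fun t ht => ?_⟩
  rw [← hN t (by omega)]
  apply Finset.sum_congr rfl
  intro d _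
  rw [Finset.prod_apply]
  rw [Finset.prod_congr rfl (fun i _ => hF' i (t, fun p => (d p : ℕ)) ⟨by dsimp only; omega, fun p => (d p).2⟩)]
  by_cases hall : ∀ i, ∑ j, evalAt (A i j) t * dec n J K t (fun p => (d p : ℕ)) j ≤ evalAt (b i) t
  · rw [ind_true hall, Finset.prod_eq_one]
    intro i _
    rw [ind_true]
    have := hall i
    dsimp only
    linarith
  · rw [ind_false hall]
    push Not at hall
    obtain ⟨i, hi⟩ := hall
    rw [Finset.prod_eq_zero (Finset.mem_univ i)]
    rw [ind_false]
    dsimp only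
    linarith

/-- Chen–Li–Sam: the number of lattice points of the parametric
polyhedron `{x ∈ ℝ^n : A(t) x ≤ b(t)}`, assumed bounded for all `t > 0`,
is an eventually quasi-polynomial function of `t`. -/
theorem count_lattice_points_eqp (n m : ℕ) (hn : 0 < n) (hm : 0 < m)
    (A : Matrix (Fin m) (Fin n) (Polynomial ℤ)) (b : Fin m → Polynomial ℤ)
    (hbdd : ∀ t : ℕ, 0 < t → Bornology.IsBounded
      {x : Fin n → ℝ | ∀ i, ∑ j, (evalAt (A i j) t : ℝ) * x j ≤ (evalAt (b i) t : ℝ)}) :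
    IsEQP (fun t => ({x : Fin n → ℤ |
      ∀ i, ∑ j, evalAt (A i j) t * x j ≤ evalAt (b i) t}.ncard : ℤ)) := by
  classical
  obtain ⟨K, hK⟩ := poly_bound n (List.ofFn fun i => ((fun j => A i j), b i)) (by
    filter_upwards [Filter.eventually_gt_atTop 0] with t ht
    obtain ⟨R, hR⟩ := isBounded_iff_forall_norm_le.1 (hbdd t ht)
    refine ⟨R, fun x hx i => ?_⟩
    refine le_trans (norm_le_pi_norm x i) (hR x ?_)
    intro i
    exact hx ((fun j => A i j), b i) ((List.mem_ofFn' _ _).2 ⟨i, rfl⟩))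
  obtain ⟨N0, hN0⟩ := Filter.eventually_atTop.1 hK
  obtain ⟨h, ⟨D, hD, P, hP⟩, N, hN⟩ := count_eq n m (K + 2) K A b
  refine ⟨D, hD, P, max (max N0 N) 2, fun t ht => ?_⟩
  rw [← hP, ← hN t (by omega)]
  have e : {x : Fin n → ℤ | ∀ i, ∑ j, evalAt (A i j) t * x j ≤ evalAt (b i) t} =
      Set.image (fun d : Fin n × Fin (K + 2) → Fin t => dec n (K + 2) K t (fun p => (d p : ℕ)))
      (Finset.univ.filter fun d : Fin n × Fin (K + 2) → Fin t =>
        ∀ i, ∑ j, evalAt (A i j) t * dec n (K + 2) K t (fun p => (d p : ℕ)) j ≤ evalAt (b i) t : Finset _) := by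
    ext x
    constructor
    · intro hx
      have hb := hN0 t (by omega) (fun j => (x j : ℝ)) (by
        intro c hc
        obtain ⟨i, rfl⟩ := (List.mem_ofFn' _ _).1 hc
        have := hx i
        simp only [ev]
        unfold evalAt at this
        exact_mod_cast this)
      have hb' : ∀ i, |x i| ≤ (t : ℤ) ^ K := fun i => by
        have := hb i
        exact_mod_cast this
      obtain ⟨d, hd⟩ := dec_surj n (K + 2) K t x
        (fun i => by have := (abs_le.1 (hb' i)).1; linarith)
        (fun i => by
          have := (abs_le.1 (hb' i)).2
          have ht2 : (2 : ℤ) ≤ t := by exact_mod_cast (by omega : 2 ≤ t)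
          have : (0 : ℤ) < (t : ℤ) ^ K := by positivity
          have h4 : (4 : ℤ) ≤ (t : ℤ) ^ 2 := by nlinarith
          have h5 := mul_le_mul_of_nonneg_left h4 this.le
          rw [pow_add]
          linarith)
      refine ⟨d, ?_, hd⟩
      simp only [Finset.coe_filter, Finset.mem_univ, true_and, Set.mem_ofPred_eq, hd]
      exact hx
    · rintro ⟨d, hd, rfl⟩
      simpa using hd
  dsimp only
  rw [e, Set.ncard_image_of_injective _ (dec_inj n (K + 2) K t), Set.ncard_coe_finset,
    Finset.card_filter]
  push_cast
  apply Finset.sum_congr rfl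
  intro d _
  unfold ind
  split_ifs <;> simp
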